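/- arXiv:2101.10365 — 2 statements merged into one kernel-verified Lean document; each statement's English description precedes it below -/
import Mathlib

section
/- Let f : ℝ^n × ℝ^n → ℝ^n be continuous and δ^r-homogeneous of degree μ with μ ≥ -min_{i=1,…,n} r_i. Then for each i = 1,…,n there exists a constant m_i > 0 such that |f_i(x,y)| ≤ m_i(‖x‖_{r,p}^{μ+r_i} + ‖y‖_{r,p}^{μ+r_i}) for all x, y ∈ ℝ^n. -/
set_option linter.unusedVariables false

noncomputable def hnorm (n : ℕ) (r : Fin n → ℝ) (p : ℝ) (x : Fin n → ℝ) : ℝ :=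
  (∑ i, |x i| ^ (p / r i)) ^ (1 / p)

noncomputable def pd (n : ℕ) (f : (Fin n → ℝ) → (Fin n → ℝ) → (Fin n → ℝ))
    (i j : Fin n) (x y : Fin n → ℝ) : ℝ :=
  deriv (fun t => f (Function.update x j t) y i) (x j)

noncomputable def vfun (n : ℕ) (r : Fin n → ℝ) (p h μ γ w1 w2 : ℝ)
    (f : (Fin n → ℝ) → (Fin n → ℝ) → (Fin n → ℝ)) (V : (Fin n → ℝ) → ℝ)
    (φ : ℝ → Fin n → ℝ) : ℝ :=
  V (φ 0) + fderiv ℝ V (φ 0) (∫ θ in (-h)..(0:ℝ), f (φ 0) (φ θ))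
    + ∫ θ in (-h)..(0:ℝ), (w1 + (h + θ) * w2) * hnorm n r p (φ θ) ^ (γ + μ)

noncomputable def segNorm (n : ℕ) (r : Fin n → ℝ) (p h : ℝ)
    (x : ℝ → Fin n → ℝ) (t : ℝ) : ℝ :=
  sSup ((fun θ => hnorm n r p (x (t + θ))) '' Set.Icc (-h) 0)

def IsSol (n : ℕ) (h : ℝ) (f : (Fin n → ℝ) → (Fin n → ℝ) → (Fin n → ℝ))
    (x : ℝ → Fin n → ℝ) : Prop :=
  ContinuousOn x (Set.Ici (-h)) ∧
  ∀ t : ℝ, 0 ≤ t → HasDerivWithinAt x (f (x t) (x (t - h))) (Set.Ici 0) t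

theorem hnorm_nonneg (n : ℕ) (r : Fin n → ℝ) (p : ℝ) (x : Fin n → ℝ) :
    0 ≤ hnorm n r p x := by
  unfold hnorm
  positivity

theorem abs_apply_le_hnorm_rpow {n : ℕ} {r : Fin n → ℝ} {p : ℝ} (hp : 0 < p) {k : Fin n}
    (hk : 0 < r k) (x : Fin n → ℝ) : |x k| ≤ hnorm n r p x ^ r k := by
  have hS : |x k| ^ (p / r k) ≤ ∑ i, |x i| ^ (p / r i) :=
    Finset.single_le_sum (f := fun i => |x i| ^ (p / r i)) (fun i _ => by positivity)
      (Finset.mem_univ k)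
  calc |x k| = (|x k| ^ (p / r k)) ^ (1 / p * r k) := by
        rw [← Real.rpow_mul (abs_nonneg _), show p / r k * (1 / p * r k) = 1 by field_simp,
          Real.rpow_one]
    _ ≤ (∑ i, |x i| ^ (p / r i)) ^ (1 / p * r k) := by gcongr
    _ = hnorm n r p x ^ r k := by
        rw [hnorm, ← Real.rpow_mul (by positivity)]

theorem dilation_mem_Icc {n : ℕ} {r : Fin n → ℝ} (hr : ∀ i, 0 < r i) {p : ℝ} (hp : 0 < p)
    {N : ℝ} (hN : 0 < N) {x : Fin n → ℝ} (hx : hnorm n r p x ≤ N) :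
    (fun k => N⁻¹ ^ r k * x k) ∈ Set.Icc (-1 : Fin n → ℝ) 1 := by
  have h : ∀ k, |N⁻¹ ^ r k * x k| ≤ 1 := fun k => by
    rw [abs_mul, abs_of_pos (by positivity), Real.inv_rpow hN.le,
      inv_mul_le_iff₀ (by positivity), mul_one]
    exact (abs_apply_le_hnorm_rpow hp (hr k) x).trans
      (Real.rpow_le_rpow (hnorm_nonneg n r p x) hx (hr k).le)
  exact ⟨fun k => (abs_le.mp (h k)).1, fun k => (abs_le.mp (h k)).2⟩

theorem stmt0
    (n : ℕ) (hn : 1 ≤ n) (r : Fin n → ℝ) (hr : ∀ i, 0 < r i) (p : ℝ) (hp : 1 ≤ p)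
    (μ : ℝ) (hμ : ∀ i, -r i ≤ μ)
    (f : (Fin n → ℝ) → (Fin n → ℝ) → (Fin n → ℝ))
    (hf_cont : Continuous fun q : (Fin n → ℝ) × (Fin n → ℝ) => f q.1 q.2)
    (hf_hom : ∀ ε : ℝ, 0 < ε → ∀ x y : Fin n → ℝ, ∀ i,
      f (fun k => ε ^ r k * x k) (fun k => ε ^ r k * y k) i = ε ^ (μ + r i) * f x y i) :
    ∀ i : Fin n, ∃ mi : ℝ, 0 < mi ∧ ∀ x y : Fin n → ℝ,
      |f x y i| ≤ mi * (hnorm n r p x ^ (μ + r i) + hnorm n r p y ^ (μ + r i)) := by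
  intro i
  have hp0 : 0 < p := by linarith
  have hs : 0 ≤ μ + r i := by linarith [hμ i]
  obtain ⟨C, hC⟩ := ((isCompact_Icc (a := (-1 : Fin n → ℝ)) (b := 1)).prod
    (isCompact_Icc (a := (-1 : Fin n → ℝ)) (b := 1))).exists_bound_of_continuousOn
    ((continuous_apply i).comp hf_cont).continuousOn
  have hM : 0 < max C 1 := lt_max_of_lt_right one_pos
  refine ⟨max C 1, hM, fun x y => ?_⟩
  have hx := hnorm_nonneg n r p x
  have hy := hnorm_nonneg n r p y
  have hN0 : 0 ≤ max (hnorm n r p x) (hnorm n r p y) := le_max_of_le_left hx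
  have key : ∀ N, max (hnorm n r p x) (hnorm n r p y) < N →
      |f x y i| ≤ max C 1 * N ^ (μ + r i) := fun N hN => by
    have hNpos : 0 < N := hN0.trans_lt hN
    have hb := hC (_, _) ⟨dilation_mem_Icc hr hp0 hNpos ((le_max_left _ _).trans hN.le),
      dilation_mem_Icc hr hp0 hNpos ((le_max_right _ _).trans hN.le)⟩
    simp only [Function.comp_apply] at hb
    rw [hf_hom _ (inv_pos.mpr hNpos), Real.norm_eq_abs, abs_mul, abs_of_pos (by positivity),
      Real.inv_rpow hNpos.le, inv_mul_le_iff₀ (by positivity), mul_comm] at hb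
    exact hb.trans (by gcongr; exact le_max_left _ _)
  have hlim : |f x y i| ≤ max C 1 * max (hnorm n r p x) (hnorm n r p y) ^ (μ + r i) :=
    ge_of_tendsto
      (((continuous_const.mul (Real.continuous_rpow_const hs)).tendsto _).mono_left
        nhdsWithin_le_nhds)
      (Filter.eventually_of_mem (self_mem_nhdsWithin (s := Set.Ioi _)) key)
  refine hlim.trans (mul_le_mul_of_nonneg_left ?_ hM.le)
  have hxs := Real.rpow_nonneg hx (μ + r i)
  have hys := Real.rpow_nonneg hy (μ + r i)
  rcases max_choice (hnorm n r p x) (hnorm n r p y) with h | h <;> rw [h] <;> linarith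
end

section
/- Let χ > 0 be chosen so that a_2 := w_1 − Σ_{i=1}^n β_i m_i χ^{2(γ−r_i)} > 0, and let 0 < δ < H_1 := (α_0 / (h Σ_{i=1}^n β_i m_i (1 + χ^{−2(μ+r_i)})))^{1/μ}. Then a_1 := α_0 − h Σ_{i=1}^n β_i m_i (1 + χ^{−2(μ+r_i)}) δ^μ > 0 and for every φ ∈ C([−h,0],ℝ^n) with ‖φ‖_H ≤ δ one has v(φ) ≥ a_1 ‖φ(0)‖_{r,p}^γ + a_2 ∫_{−h}^{0} ‖φ(θ)‖_{r,p}^{γ+μ} dθ. -/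
set_option linter.unusedVariables false

theorem continuous_hnorm {n : ℕ} {r : Fin n → ℝ} {p : ℝ} (hr : ∀ i, 0 < r i) (hp : 0 ≤ p) :
    Continuous (hnorm n r p) := by
  unfold hnorm
  refine Continuous.rpow_const ?_ fun _ => Or.inr (by positivity)
  refine continuous_finsetSum _ fun i _ => ?_
  exact (continuous_apply i).abs.rpow_const fun _ => Or.inr (div_nonneg hp (hr i).le)

/-- A weighted Young-type inequality for products of real powers. -/
theorem rpow_mul_rpow_le_add {a b c A B : ℝ} (ha : 0 ≤ a) (hb : 0 ≤ b) (hc : 0 < c)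
    (hA : 0 < A) (hB : 0 < B) :
    a ^ A * b ^ B ≤ c ^ (-2 * B) * a ^ (A + B) + c ^ (2 * A) * b ^ (A + B) := by
  have hc2 : 0 ≤ c ^ (2 : ℝ) := by positivity
  have hcB : c ^ (-2 * B) * c ^ (2 * B) = 1 := by
    rw [← Real.rpow_add hc]; simp
  rw [Real.rpow_add_of_nonneg ha hA.le hB.le, Real.rpow_add_of_nonneg hb hA.le hB.le]
  rcases le_total (c ^ (2 : ℝ) * b) a with hab | hab
  · have key := Real.rpow_le_rpow (by positivity) hab hB.le
    rw [Real.mul_rpow hc2 hb, ← Real.rpow_mul hc.le] at key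
    calc a ^ A * b ^ B = c ^ (-2 * B) * (a ^ A * (c ^ (2 * B) * b ^ B)) := by
          linear_combination (-(a ^ A * b ^ B)) * hcB
      _ ≤ c ^ (-2 * B) * (a ^ A * a ^ B) := by gcongr
      _ ≤ _ := le_add_of_nonneg_right (by positivity)
  · have key := Real.rpow_le_rpow ha hab hA.le
    rw [Real.mul_rpow hc2 hb, ← Real.rpow_mul hc.le] at key
    calc a ^ A * b ^ B ≤ (c ^ (2 * A) * b ^ A) * b ^ B := by gcongr
      _ = c ^ (2 * A) * (b ^ A * b ^ B) := by ring
      _ ≤ _ := le_add_of_nonneg_left (by positivity)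

/-- Coordinatewise bounds on a linear functional and on a vector give a bound on the value. -/
theorem abs_apply_le_sum_mul {n : ℕ} (L : (Fin n → ℝ) →L[ℝ] ℝ) (z b c : Fin n → ℝ)
    (hb : ∀ i, |L (Pi.single i 1)| ≤ b i) (hc : ∀ i, |z i| ≤ c i) :
    |L z| ≤ ∑ i, b i * c i := by
  have hL : L z = ∑ i, L (Pi.single i 1) * z i := by
    conv_lhs => rw [pi_eq_sum_univ' z]
    rw [map_sum]
    refine Finset.sum_congr rfl fun i _ => ?_
    rw [map_smul, smul_eq_mul, mul_comm]
  rw [hL]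
  refine (Finset.abs_sum_le_sum_abs _ _).trans (Finset.sum_le_sum fun i _ => ?_)
  rw [abs_mul]
  exact mul_le_mul (hb i) (hc i) (abs_nonneg _) ((abs_nonneg _).trans (hb i))

theorem stmt3
    (n : ℕ) (hn : 1 ≤ n) (r : Fin n → ℝ) (hr : ∀ i, 0 < r i) (p : ℝ) (hp : 1 ≤ p)
    (h μ : ℝ) (hh : 0 < h) (hμ : 0 < μ)
    (f : (Fin n → ℝ) → (Fin n → ℝ) → (Fin n → ℝ))
    (hf_cont : Continuous fun q : (Fin n → ℝ) × (Fin n → ℝ) => f q.1 q.2)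
    (hf_hom : ∀ ε : ℝ, 0 < ε → ∀ x y : Fin n → ℝ, ∀ i,
      f (fun k => ε ^ r k * x k) (fun k => ε ^ r k * y k) i = ε ^ (μ + r i) * f x y i)
    (m : Fin n → ℝ) (hm : ∀ i, 0 < m i)
    (hfm : ∀ x y : Fin n → ℝ, ∀ i,
      |f x y i| ≤ m i * (hnorm n r p x ^ (μ + r i) + hnorm n r p y ^ (μ + r i)))
    (V : (Fin n → ℝ) → ℝ) (hV : ContDiff ℝ 1 V)
    (α0 α1 γ : ℝ) (hα0 : 0 < α0) (hα1 : 0 < α1) (hγ : ∀ i, 2 * r i ≤ γ)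
    (hVlb : ∀ x : Fin n → ℝ, α0 * hnorm n r p x ^ γ ≤ V x)
    (hVub : ∀ x : Fin n → ℝ, V x ≤ α1 * hnorm n r p x ^ γ)
    (β : Fin n → ℝ) (hβ : ∀ i, 0 < β i)
    (hVd : ∀ x : Fin n → ℝ, ∀ i,
      |fderiv ℝ V x (Pi.single i 1)| ≤ β i * hnorm n r p x ^ (γ - r i))
    (w1 w2 : ℝ) (hw1 : 0 < w1) (hw2 : 0 < w2)
    (χ : ℝ) (hχ : 0 < χ)
    (a2 : ℝ) (ha2def : a2 = w1 - ∑ i, β i * m i * χ ^ (2 * (γ - r i))) (ha2 : 0 < a2)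
    (H1 : ℝ) (hH1def : H1 = (α0 / (h * ∑ i, β i * m i * (1 + χ ^ (-2 * (μ + r i))))) ^ (1 / μ))
    (δ : ℝ) (hδ0 : 0 < δ) (hδH1 : δ < H1)
    (a1 : ℝ) (ha1def : a1 = α0 - h * (∑ i, β i * m i * (1 + χ ^ (-2 * (μ + r i)))) * δ ^ μ)
    :
    0 < a1 ∧ ∀ φ : ℝ → Fin n → ℝ, ContinuousOn φ (Set.Icc (-h) 0) →
      (∀ θ ∈ Set.Icc (-h) (0:ℝ), hnorm n r p (φ θ) ≤ δ) →
      a1 * hnorm n r p (φ 0) ^ γ + a2 * ∫ θ in (-h)..(0:ℝ), hnorm n r p (φ θ) ^ (γ + μ)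
        ≤ vfun n r p h μ γ w1 w2 f V φ := by
  have hp0 : 0 ≤ p := zero_le_one.trans hp
  have i₀ : Fin n := ⟨0, hn⟩
  have hγ0 : 0 < γ := by linarith [hγ i₀, hr i₀]
  set S := ∑ i, β i * m i * (1 + χ ^ (-2 * (μ + r i))) with hS
  set C := ∑ i, β i * m i * χ ^ (2 * (γ - r i)) with hC
  have hS0 : 0 < S := Finset.sum_pos
    (fun i _ => by have := hβ i; have := hm i; positivity) ⟨i₀, Finset.mem_univ _⟩
  constructor
  · have hδμ : δ ^ μ < α0 / (h * S) := by
      have := Real.rpow_lt_rpow hδ0.le (hH1def ▸ hδH1) hμ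
      rwa [← Real.rpow_mul (by positivity), one_div_mul_cancel hμ.ne', Real.rpow_one] at this
    rw [lt_div_iff₀ (by positivity)] at hδμ
    rw [ha1def]
    linarith
  intro φ hφ hφδ
  have h0 : (0 : ℝ) ∈ Set.Icc (-h) 0 := ⟨by linarith, le_rfl⟩
  have hle : -h ≤ 0 := h0.1
  have huIcc : Set.uIcc (-h) 0 = Set.Icc (-h) 0 := Set.uIcc_of_le hle
  set N := hnorm n r p (φ 0)
  have hN0 : 0 ≤ N := hnorm_nonneg ..
  set L := fderiv ℝ V (φ 0)
  set g : ℝ → ℝ := fun θ => hnorm n r p (φ θ) ^ (γ + μ)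
  have hg0 : ∀ θ, 0 ≤ g θ := fun θ => Real.rpow_nonneg (hnorm_nonneg ..) _
  have hgc : ContinuousOn g (Set.uIcc (-h) 0) := huIcc ▸
    ((continuous_hnorm hr hp0).comp_continuousOn hφ).rpow_const
      fun _ _ => Or.inr (by positivity)
  have hfc : ContinuousOn (fun θ => f (φ 0) (φ θ)) (Set.uIcc (-h) 0) := huIcc ▸
    hf_cont.comp_continuousOn (continuousOn_const.prodMk hφ)
  have hLfc : ContinuousOn (fun θ => L (f (φ 0) (φ θ))) (Set.uIcc (-h) 0) :=
    L.continuous.comp_continuousOn hfc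
  have hwc : ContinuousOn (fun θ => (w1 + (h + θ) * w2) * g θ) (Set.uIcc (-h) 0) :=
    ContinuousOn.mul (by fun_prop) hgc
  have hLf : ∀ θ, |L (f (φ 0) (φ θ))| ≤ S * N ^ (γ + μ) + C * g θ := fun θ => by
    refine (abs_apply_le_sum_mul L _ _ _ (hVd (φ 0)) (hfm (φ 0) (φ θ))).trans ?_
    rw [hS, hC, Finset.sum_mul, Finset.sum_mul, ← Finset.sum_add_distrib]
    refine Finset.sum_le_sum fun i _ => ?_
    have hA : 0 < γ - r i := by linarith [hγ i, hr i]
    have hB : 0 < μ + r i := add_pos hμ (hr i)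
    have hAB : γ - r i + (μ + r i) = γ + μ := by ring
    have key := rpow_mul_rpow_le_add hN0 (hnorm_nonneg n r p (φ θ)) hχ hA hB
    have hpow := Real.rpow_add_of_nonneg hN0 hA.le hB.le
    rw [hAB] at key hpow
    have hβm : 0 ≤ β i * m i := (mul_pos (hβ i) (hm i)).le
    calc _ = β i * m i * (N ^ (γ + μ) + N ^ (γ - r i) * hnorm n r p (φ θ) ^ (μ + r i)) := by
          rw [hpow]; ring
      _ ≤ β i * m i * (N ^ (γ + μ) + (χ ^ (-2 * (μ + r i)) * N ^ (γ + μ)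
            + χ ^ (2 * (γ - r i)) * g θ)) := by gcongr
      _ = _ := by ring
  have hint : ∫ θ in (-h)..0, (a2 * g θ - S * N ^ (γ + μ)) ≤
      ∫ θ in (-h)..0, (L (f (φ 0) (φ θ)) + (w1 + (h + θ) * w2) * g θ) := by
    refine intervalIntegral.integral_mono_on hle
      ((hgc.const_mul a2).sub continuousOn_const).intervalIntegrable
      (hLfc.add hwc).intervalIntegrable fun θ hθ => ?_
    have h1 := (abs_le.1 (hLf θ)).1
    have h2 : 0 ≤ (h + θ) * w2 * g θ :=
      mul_nonneg (mul_nonneg (by linarith [hθ.1]) hw2.le) (hg0 θ)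
    rw [ha2def]
    linarith
  rw [intervalIntegral.integral_add hLfc.intervalIntegrable hwc.intervalIntegrable,
    intervalIntegral.integral_sub (hgc.const_mul a2).intervalIntegrable
      intervalIntegrable_const, intervalIntegral.integral_const_mul,
    intervalIntegral.integral_const,
    L.intervalIntegral_comp_comm hfc.intervalIntegrable, smul_eq_mul] at hint
  have hNδ : N ^ (γ + μ) ≤ N ^ γ * δ ^ μ := by
    rw [Real.rpow_add_of_nonneg hN0 hγ0.le hμ.le]
    gcongr
    exact hφδ 0 h0
  have hhS := mul_le_mul_of_nonneg_left hNδ (mul_pos hh hS0).le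
  have hV0 := hVlb (φ 0)
  unfold vfun
  rw [ha1def]
  linarith
end
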